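/- There is no algorithm for the implication problem of regular graph constraints over the class of heaps: encoding finite graphs (say, graphs whose node set is Fin n for some n, encoded as natural numbers via a standard encoding of the data ⟨n, s1, s2, null, root⟩) as natural numbers, the set of pairs of graphs ⟨G1, G2⟩ such that G1 ⇝_H G2 is not a computable (decidable) set, where H is the class of all heaps. -/

import Mathlib

universe u v w

/-- A (pre)graph: a node set `V` inside an ambient type, two edge relations
`s1` and `s2`, and distinguished constants `null` and `root`. -/
structure PreGraph (α : Type u) where
  V : Set α
  s1 : α → α → Prop
  s2 : α → α → Prop
  null : α
  root : α

namespace PreGraph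

/-- `G` is a graph: `V` is finite, `root` and `null` are distinct nodes of `V`,
edges lie within `V`, and `⟨null, x⟩ ∈ sᵢ` iff `x = null`. -/
def IsGraph {α : Type u} (G : PreGraph α) : Prop :=
  G.V.Finite ∧
  G.null ∈ G.V ∧ G.root ∈ G.V ∧ G.root ≠ G.null ∧
  (∀ x y, G.s1 x y → x ∈ G.V ∧ y ∈ G.V) ∧
  (∀ x y, G.s2 x y → x ∈ G.V ∧ y ∈ G.V) ∧
  (∀ x, G.s1 G.null x ↔ x = G.null) ∧
  (∀ x, G.s2 G.null x ↔ x = G.null)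

/-- `h` is a homomorphism from `G` to `G'`. -/
def IsHom {α : Type u} {β : Type v} (G : PreGraph α) (G' : PreGraph β) (h : α → β) : Prop :=
  (∀ x ∈ G.V, h x ∈ G'.V) ∧
  (∀ x y, G.s1 x y → G'.s1 (h x) (h y)) ∧
  (∀ x y, G.s2 x y → G'.s2 (h x) (h y)) ∧
  (∀ x ∈ G.V, (h x = G'.root ↔ x = G.root)) ∧
  (∀ x ∈ G.V, (h x = G'.null ↔ x = G.null))

/-- `G → G'` : there exists a homomorphism from `G` to `G'`. -/
def Maps {α : Type u} {β : Type v} (G : PreGraph α) (G' : PreGraph β) : Prop :=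
  ∃ h : α → β, IsHom G G' h

/-- An edge of `G` (either an `s1`- or an `s2`-edge). -/
def edge {α : Type u} (G : PreGraph α) (x y : α) : Prop := G.s1 x y ∨ G.s2 x y

/-- `G` is a heap: a graph in which `s1` and `s2` are total functions on `V`
and every node other than `null` is reachable from `root`. -/
def IsHeap {α : Type u} (G : PreGraph α) : Prop :=
  IsGraph G ∧
  (∀ x ∈ G.V, ∃! y, G.s1 x y) ∧
  (∀ x ∈ G.V, ∃! y, G.s2 x y) ∧
  (∀ x ∈ G.V, x ≠ G.null → Relation.ReflTransGen G.edge G.root x)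

end PreGraph

/-- `G1 ⇝_H G2` : implication over the class of all heaps. -/
def HeapImplies {α : Type u} {β : Type v} (G1 : PreGraph α) (G2 : PreGraph β) : Prop :=
  ∀ (γ : Type) (H : PreGraph γ), PreGraph.IsHeap H →
    PreGraph.Maps H G1 → PreGraph.Maps H G2

/-- A finite graph whose node set is `Fin n`, with concrete (`Bool`-valued)
edge relations, so that it can be encoded as a natural number. -/
structure FinGraph where
  n : ℕ
  s1 : Fin n → Fin n → Bool
  s2 : Fin n → Fin n → Bool
  null : Fin n
  root : Fin n
  root_ne_null : root ≠ null
  null_s1 : ∀ x, s1 null x = true ↔ x = null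
  null_s2 : ∀ x, s2 null x = true ↔ x = null

/-- The graph (with node set `Fin n`) determined by a `FinGraph`. -/
def FinGraph.toPreGraph (G : FinGraph) : PreGraph (Fin G.n) where
  V := Set.univ
  s1 := fun x y => G.s1 x y = true
  s2 := fun x y => G.s2 x y = true
  null := G.null
  root := G.root

/-- The data `⟨n, s1, s2, null, root⟩` of a finite graph. -/
abbrev GraphData : Type :=
  Σ n : ℕ, (Fin n → Fin n → Bool) × (Fin n → Fin n → Bool) × Fin n × Fin n

/-- A standard encoding of finite graphs as natural numbers, via the standard
encoding of the data `⟨n, s1, s2, null, root⟩`. -/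
def FinGraph.encode (G : FinGraph) : ℕ :=
  Encodable.encode (⟨G.n, G.s1, G.s2, G.null, G.root⟩ : GraphData)

/-- A standard encoding of pairs of finite graphs as natural numbers. -/
def encodePair (G1 G2 : FinGraph) : ℕ := Nat.pair G1.encode G2.encode

/-! ### Navigation and local formulas -/

namespace HeapUndec

set_option linter.unusedSimpArgs false

/-- Follow the word `p` from `x`. -/
def nav {γ : Type} (f : Bool → γ → γ) (p : List Bool) (x : γ) : γ :=
  p.foldl (fun y i => f i y) x

@[simp] lemma nav_nil {γ : Type} (f : Bool → γ → γ) (x : γ) : nav f [] x = x := rfl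

@[simp] lemma nav_cons {γ : Type} (f : Bool → γ → γ) (i : Bool) (p : List Bool) (x : γ) :
    nav f (i :: p) x = nav f p (f i x) := rfl

lemma nav_append {γ : Type} (f : Bool → γ → γ) (p q : List Bool) (x : γ) :
    nav f (p ++ q) x = nav f q (nav f p x) := by
  simp [nav, List.foldl_append]

/-- Local formulas: positive in equalities of paths. -/
inductive Fm : Type
  | fls : Fm
  | nul : List Bool → Fm
  | nn : List Bool → Fm
  | eq : List Bool → List Bool → Fm
  | conj : Fm → Fm → Fm
  | disj : Fm → Fm → Fm

namespace Fm

def eval (N : List Bool → Prop) (E : List Bool → List Bool → Prop) : Fm → Prop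
  | fls => False
  | nul p => N p
  | nn p => ¬ N p
  | eq p q => E p q
  | conj a b => eval N E a ∧ eval N E b
  | disj a b => eval N E a ∨ eval N E b

def bd : Fm → ℕ
  | fls => 0
  | nul p => p.length
  | nn p => p.length
  | eq p q => max p.length q.length
  | conj a b => max a.bd b.bd
  | disj a b => max a.bd b.bd

lemma eval_mono {N N' : List Bool → Prop} {E E' : List Bool → List Bool → Prop} {K : ℕ}
    (hN : ∀ p, p.length ≤ K → (N p ↔ N' p))
    (hE : ∀ p q, p.length ≤ K → q.length ≤ K → E p q → E' p q) :
    ∀ φ : Fm, φ.bd ≤ K → φ.eval N E → φ.eval N' E'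
  | fls, _, h => h
  | nul p, hb, h => (hN p hb).1 h
  | nn p, hb, h => fun h' => h ((hN p hb).2 h')
  | eq p q, hb, h => hE p q (le_trans (le_max_left _ _) hb) (le_trans (le_max_right _ _) hb) h
  | conj a b, hb, h =>
      ⟨eval_mono hN hE a (le_trans (le_max_left _ _) hb) h.1,
       eval_mono hN hE b (le_trans (le_max_right _ _) hb) h.2⟩
  | disj a b, hb, h => h.imp
      (eval_mono hN hE a (le_trans (le_max_left _ _) hb))
      (eval_mono hN hE b (le_trans (le_max_right _ _) hb))

/-- case distinction on whether `p` is null -/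
def cond (p : List Bool) (a b : Fm) : Fm := disj (conj (nul p) a) (conj (nn p) b)

def tagIs (p : List Bool) : ℕ → Fm
  | 0 => nul p
  | i + 1 => conj (nn p) (tagIs (p ++ [false]) i)

def tagSwitch (p : List Bool) : List Fm → Fm
  | [] => fls
  | a :: l => cond p a (tagSwitch (p ++ [false]) l)

end Fm

/-- Satisfaction of a formula at a node. -/
def Sat {γ : Type} (f : Bool → γ → γ) (z : γ) (φ : Fm) (x : γ) : Prop :=
  φ.eval (fun p => nav f p x = z) (fun p q => nav f p x = nav f q x)

/-! ### Binary trees -/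

inductive BT : Type
  | leaf : BT
  | node : BT → BT → BT

namespace BT

def child : Bool → BT → BT
  | _, leaf => leaf
  | false, node a _ => a
  | true, node _ b => b

@[simp] lemma child_leaf (i : Bool) : child i leaf = leaf := by cases i <;> rfl
@[simp] lemma child_false (a b : BT) : child false (node a b) = a := rfl
@[simp] lemma child_true (a b : BT) : child true (node a b) = b := rfl

@[simp] lemma nav_leaf (p : List Bool) : nav child p leaf = leaf := by
  induction p with
  | nil => rfl
  | cons i p ih => simp [ih]

def size : BT → ℕ
  | leaf => 0
  | node a b => size a + size b + 1

lemma size_child_le (i : Bool) (t : BT) : size (child i t) ≤ size t := by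
  cases t <;> cases i <;> simp [size] <;> omega

lemma size_child_lt (i : Bool) (t : BT) (h : t ≠ leaf) : size (child i t) < size t := by
  cases t <;> cases i <;> simp_all [size]

lemma size_nav_le (p : List Bool) : ∀ t, size (nav child p t) ≤ size t := by
  induction p with
  | nil => intro t; simp
  | cons i p ih => intro t; exact (ih _).trans (size_child_le i t)

lemma size_nav_lt (i : Bool) (p : List Bool) (t : BT) (h : t ≠ leaf) :
    size (nav child (i :: p) t) < size t :=
  (size_nav_le p _).trans_lt (size_child_lt i t h)

def natv : BT → ℕ
  | leaf => 0
  | node a _ => natv a + 1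

def listv : BT → List ℕ
  | leaf => []
  | node a b => natv a :: listv b

def num : ℕ → BT
  | 0 => leaf
  | k + 1 => node (num k) leaf

def lst : List ℕ → BT
  | [] => leaf
  | a :: l => node (num a) (lst l)

@[simp] lemma natv_num (k : ℕ) : natv (num k) = k := by
  induction k with
  | zero => rfl
  | succ k ih => simp [num, natv, ih]

@[simp] lemma listv_lst (l : List ℕ) : listv (lst l) = l := by
  induction l with
  | nil => rfl
  | cons k l ih => simp [lst, listv, ih]

lemma natv_eq_zero {t : BT} : natv t = 0 ↔ t = leaf := by
  cases t <;> simp [natv]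

lemma natv_of_ne {t : BT} (h : t ≠ leaf) : natv t = natv (child false t) + 1 := by
  cases t <;> simp_all [natv]

lemma listv_of_ne {t : BT} (h : t ≠ leaf) :
    listv t = natv (child false t) :: listv (child true t) := by
  cases t <;> simp_all [listv]

lemma headI_listv (t : BT) : (listv t).headI = natv (child false t) := by
  cases t <;> simp [listv, natv]

lemma tail_listv (t : BT) : (listv t).tail = listv (child true t) := by
  cases t <;> simp [listv]

@[simp] lemma num_false (k : ℕ) : child false (num k) = num (k - 1) := by cases k <;> rfl
@[simp] lemma num_true (k : ℕ) : child true (num k) = leaf := by cases k <;> rfl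
@[simp] lemma num_eq_leaf (k : ℕ) : num k = leaf ↔ k = 0 := by cases k <;> simp [num]
@[simp] lemma lst_false (l : List ℕ) : child false (lst l) = num l.headI := by cases l <;> rfl
@[simp] lemma lst_true (l : List ℕ) : child true (lst l) = lst l.tail := by cases l <;> rfl
@[simp] lemma lst_cons_ne (a : ℕ) (l : List ℕ) : lst (a :: l) ≠ leaf := by simp [lst]

/-- Every non-leaf subtree satisfies `φ`. -/
def Good (φ : Fm) (t : BT) : Prop :=
  ∀ p, nav child p t ≠ leaf → Sat child leaf φ (nav child p t)

lemma Good.nav {φ : Fm} {t : BT} (h : Good φ t) (p : List Bool) : Good φ (nav child p t) := by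
  intro q hq
  rw [← nav_append] at hq ⊢
  exact h _ hq

lemma good_leaf (φ : Fm) : Good φ leaf := by
  intro p hp; simp at hp

lemma good_node {φ : Fm} {a b : BT} (h : Sat child leaf φ (node a b)) (ha : Good φ a)
    (hb : Good φ b) : Good φ (node a b) := by
  intro p hp
  match p with
  | [] => exact h
  | false :: p => exact ha p hp
  | true :: p => exact hb p hp

end BT

open BT

lemma sat_tagIs (t : BT) (i : ℕ) : ∀ p,
    Sat child leaf (Fm.tagIs p i) t ↔ natv (nav child p t) = i := by
  induction i with
  | zero => intro p; simp [Fm.tagIs, Sat, Fm.eval, natv_eq_zero]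
  | succ i ih =>
    intro p
    have := ih (p ++ [false])
    simp only [Sat] at this
    simp only [Fm.tagIs, Sat, Fm.eval, this, nav_append, nav_cons, nav_nil]
    by_cases h : nav child p t = leaf
    · simp [h, natv]
    · rw [natv_of_ne h]; simp [h]

lemma sat_tagSwitch (t : BT) (l : List Fm) : ∀ p,
    Sat child leaf (Fm.tagSwitch p l) t ↔
      ∃ φ, l[natv (nav child p t)]? = some φ ∧ Sat child leaf φ t := by
  induction l with
  | nil => intro p; simp [Fm.tagSwitch, Sat, Fm.eval]
  | cons a l ih =>
    intro p
    have := ih (p ++ [false])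
    simp only [Sat] at this
    simp only [Fm.tagSwitch, Fm.cond, Sat, Fm.eval, this, nav_append, nav_cons, nav_nil]
    by_cases h : nav child p t = leaf
    · simp [h, natv]
    · rw [natv_of_ne h]; simp [h]

/-! ### Rules -/

open Turing.ToPartrec

abbrev pv : List Bool := [true]
abbrev pg : List Bool := [false, false, true]
abbrev pt : List Bool := [false, false, false]
abbrev pa : List Bool := [false, false, true, true]
abbrev pb : List Bool := [false, true, true]
abbrev pw : List Bool := [false, true, false]

/-- the node at `p` is a judgment with tag `i` -/
def isJ (p : List Bool) (i : ℕ) : Fm := .conj (.nn (p ++ pg)) (.tagIs (p ++ pt) i)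

def rule (idx : Code → ℕ) : Code → Fm
  | .zero' => .conj (.nn pw) (.conj (.nul (pw ++ [false])) (.eq (pw ++ [true]) pv))
  | .succ => .conj (.nn pw) (.conj (.nul (pw ++ [true]))
      (.conj (.nn (pw ++ [false])) (.eq (pw ++ [false, false]) (pv ++ [false]))))
  | .tail => .eq pw (pv ++ [true])
  | .cons f fs => .conj (isJ pa (idx f)) (.conj (.eq (pa ++ pv) pv)
      (.conj (isJ pb (idx fs)) (.conj (.eq (pb ++ pv) pv)
      (.conj (.nn pw) (.conj (.eq (pw ++ [false]) (pa ++ pw ++ [false]))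
        (.eq (pw ++ [true]) (pb ++ pw)))))))
  | .comp f g => .conj (isJ pa (idx g)) (.conj (.eq (pa ++ pv) pv)
      (.conj (isJ pb (idx f)) (.conj (.eq (pb ++ pv) (pa ++ pw)) (.eq pw (pb ++ pw)))))
  | .case f g => .cond (pv ++ [false])
      (.conj (isJ pa (idx f)) (.conj (.eq (pa ++ pv) (pv ++ [true])) (.eq pw (pa ++ pw))))
      (.conj (isJ pa (idx g)) (.conj (.nn (pa ++ pv))
        (.conj (.eq (pa ++ pv ++ [false]) (pv ++ [false, false]))
        (.conj (.eq (pa ++ pv ++ [true]) (pv ++ [true])) (.eq pw (pa ++ pw))))))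
  | .fix f => .conj (isJ pa (idx f)) (.conj (.eq (pa ++ pv) pv)
      (.cond (pa ++ pw ++ [false]) (.eq pw (pa ++ pw ++ [true]))
        (.conj (isJ pb (idx (.fix f))) (.conj (.eq (pb ++ pv) (pa ++ pw ++ [true]))
          (.eq pw (pb ++ pw))))))

def subs : Code → List Code
  | .zero' => [.zero']
  | .succ => [.succ]
  | .tail => [.tail]
  | .cons f g => .cons f g :: (subs f ++ subs g)
  | .comp f g => .comp f g :: (subs f ++ subs g)
  | .case f g => .case f g :: (subs f ++ subs g)
  | .fix f => .fix f :: subs f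

lemma self_mem_subs (c : Code) : c ∈ subs c := by cases c <;> simp [subs]

lemma subs_trans {c d : Code} (h : d ∈ subs c) : subs d ⊆ subs c := by
  induction c with
  | zero' => simp [subs] at h; subst h; simp
  | succ => simp [subs] at h; subst h; simp
  | tail => simp [subs] at h; subst h; simp
  | cons f g hf hg | comp f g hf hg | case f g hf hg =>
    simp only [subs, List.mem_cons, List.mem_append] at h
    rcases h with rfl | h | h
    · simp
    · intro x hx; simp [subs, hf h hx]
    · intro x hx; simp [subs, hg h hx]
  | fix f hf =>
    simp only [subs, List.mem_cons] at h
    rcases h with rfl | h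
    · simp
    · intro x hx; simp [subs, hf h hx]

open Classical in
noncomputable def cidx (c d : Code) : ℕ := (subs c).idxOf d

lemma get_cidx {c d : Code} (h : d ∈ subs c) : (subs c)[cidx c d]? = some d := by
  classical
  unfold cidx
  exact List.getElem?_idxOf h

noncomputable def Phi (c : Code) : Fm :=
  .disj (.nul pg) (.tagSwitch pt ((subs c).map (rule (cidx c))))

noncomputable def Phi0 (c : Code) : Fm := isJ [] (cidx c c)

lemma sat_isJ (t : BT) (p : List Bool) (i : ℕ) : Sat child leaf (isJ p i) t ↔
    nav child (p ++ pg) t ≠ leaf ∧ natv (nav child (p ++ pt) t) = i := by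
  have := sat_tagIs t i (p ++ pt)
  simp only [Sat] at this
  simp only [Sat, isJ, Fm.eval, this, ne_eq]

lemma sat_Phi (c : Code) (t : BT) : Sat child leaf (Phi c) t ↔
    nav child pg t = leaf ∨ ∃ d, (subs c)[natv (nav child pt t)]? = some d ∧
      Sat child leaf (rule (cidx c) d) t := by
  have := sat_tagSwitch t ((subs c).map (rule (cidx c))) pt
  simp only [Sat] at this
  simp only [Sat, Phi, Fm.eval, this]
  simp

/-- evaluation as a relation -/
def Ev (c : Code) (v w : List ℕ) : Prop := Membership.mem (γ := Part (List ℕ)) (c.eval v) w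

lemma ev_zero {v w : List ℕ} : Ev .zero' v w ↔ w = 0 :: v := by
  unfold Ev; rw [Code.zero'_eval]; exact Part.mem_some_iff

lemma ev_succ {v w : List ℕ} : Ev .succ v w ↔ w = [v.headI + 1] := by
  unfold Ev; rw [Code.succ_eval]; exact Part.mem_some_iff

lemma ev_tail {v w : List ℕ} : Ev .tail v w ↔ w = v.tail := by
  unfold Ev; rw [Code.tail_eval]; exact Part.mem_some_iff

lemma ev_cons {f g : Code} {v w : List ℕ} :
    Ev (.cons f g) v w ↔ ∃ a, Ev f v a ∧ ∃ b, Ev g v b ∧ w = a.headI :: b := by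
  unfold Ev; rw [Code.cons_eval]
  refine Part.mem_bind_iff.trans (exists_congr fun a => and_congr Iff.rfl ?_)
  exact Part.mem_bind_iff.trans (exists_congr fun b => and_congr Iff.rfl Part.mem_some_iff)

lemma ev_comp {f g : Code} {v w : List ℕ} :
    Ev (.comp f g) v w ↔ ∃ a, Ev g v a ∧ Ev f a w := by
  unfold Ev; rw [Code.comp_eval]
  exact Part.mem_bind_iff

lemma ev_case_zero {f g : Code} {v w : List ℕ} (h : v.headI = 0) :
    Ev (.case f g) v w ↔ Ev f v.tail w := by
  unfold Ev; rw [Code.case_eval]; simp only [h]; exact Iff.rfl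

lemma ev_case_succ {f g : Code} {v w : List ℕ} {m : ℕ} (h : v.headI = m + 1) :
    Ev (.case f g) v w ↔ Ev g (m :: v.tail) w := by
  unfold Ev; rw [Code.case_eval]; simp only [h]

lemma ev_fix_inl {f : Code} {v u : List ℕ} (hu : Ev f v u) (h : u.headI = 0) :
    Ev (.fix f) v u.tail := by
  unfold Ev; rw [Code.fix_eval]
  refine PFun.mem_fix_iff.2 (Or.inl ((Part.mem_map_iff _).2 ⟨u, hu, ?_⟩))
  simp [h]

lemma ev_fix_inr {f : Code} {v u w : List ℕ} (hu : Ev f v u) (h : u.headI ≠ 0)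
    (hw : Ev (.fix f) u.tail w) : Ev (.fix f) v w := by
  unfold Ev at hw ⊢; rw [Code.fix_eval] at hw ⊢
  refine PFun.mem_fix_iff.2 (Or.inr ⟨u.tail, (Part.mem_map_iff _).2 ⟨u, hu, ?_⟩, hw⟩)
  simp [h]

lemma ev_fix_ind {f : Code} {w : List ℕ} (C : List ℕ → Prop)
    (h1 : ∀ v u, Ev f v u → u.headI = 0 → w = u.tail → C v)
    (h2 : ∀ v u, Ev f v u → u.headI ≠ 0 → C u.tail → C v) {v : List ℕ}
    (hw : Ev (.fix f) v w) : C v := by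
  unfold Ev at hw; rw [Code.fix_eval] at hw
  refine PFun.fixInduction' (C := C) hw ?_ ?_
  · intro v hv
    obtain ⟨u, hu, he⟩ := (Part.mem_map_iff _).1 hv
    split_ifs at he with h0
    cases he
    exact h1 v u hu h0 rfl
  · intro v v' _ hv hv'
    obtain ⟨u, hu, he⟩ := (Part.mem_map_iff _).1 hv
    split_ifs at he with h0
    cases he
    exact h2 v u hu h0 hv'

lemma sound (c : Code) : ∀ (k : ℕ) (J : BT), size J ≤ k → Good (Phi c) J →
    nav child pg J ≠ leaf → ∀ d ∈ subs c, natv (nav child pt J) = cidx c d →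
    Ev d (listv (nav child pv J)) (listv (nav child pw J)) := by
  intro k
  induction k with
  | zero =>
    intro J hJ _ hg
    cases J with
    | leaf => simp at hg
    | node a b => simp [size] at hJ
  | succ k ih =>
    intro J hJ hG hg d hd hi
    have hne : J ≠ leaf := by rintro rfl; simp at hg
    have hs : Sat child leaf (rule (cidx c) d) J := by
      have := (sat_Phi c J).1 (hG [] hne)
      rcases this with h | ⟨d', h1, h2⟩
      · exact absurd h hg
      · rw [hi, get_cidx hd] at h1
        cases h1; exact h2
    have ha := ih (nav child pa J) (Nat.lt_succ_iff.1 ((size_nav_lt _ _ J hne).trans_le hJ))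
      (hG.nav pa)
    have hb := ih (nav child pb J) (Nat.lt_succ_iff.1 ((size_nav_lt _ _ J hne).trans_le hJ))
      (hG.nav pb)
    have hsub := subs_trans hd
    have hJa := fun i => sat_isJ J pa i
    have hJb := fun i => sat_isJ J pb i
    simp only [Sat] at hJa hJb
    cases d with
    | zero' =>
      simp only [Sat, rule, Fm.eval, hJa, hJb, Fm.cond] at hs
      simp only [List.cons_append, List.nil_append, nav_cons, nav_nil, ne_eq] at *
      obtain ⟨h1, h2, h3⟩ := hs
      rw [ev_zero, listv_of_ne h1, h2, h3]
      rfl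
    | succ =>
      simp only [Sat, rule, Fm.eval, hJa, hJb, Fm.cond] at hs
      simp only [List.cons_append, List.nil_append, nav_cons, nav_nil, ne_eq] at *
      obtain ⟨h1, h2, h3, h4⟩ := hs
      rw [ev_succ, listv_of_ne h1, h2, natv_of_ne h3, h4, headI_listv]
      rfl
    | tail =>
      simp only [Sat, rule, Fm.eval, hJa, hJb, Fm.cond] at hs
      simp only [List.cons_append, List.nil_append, nav_cons, nav_nil, ne_eq] at *
      rw [ev_tail, hs, tail_listv]
    | cons f fs =>
      simp only [Sat, rule, Fm.eval, hJa, hJb, Fm.cond] at hs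
      simp only [List.cons_append, List.nil_append, nav_cons, nav_nil, ne_eq] at *
      obtain ⟨h1, h2, h3, h4, h5, h6, h7⟩ := hs
      have e1 := ha h1.1 f (hsub (by simp [subs, self_mem_subs])) h1.2
      have e2 := hb h3.1 fs (hsub (by simp [subs, self_mem_subs])) h3.2
      rw [h2] at e1
      rw [h4] at e2
      refine ev_cons.2 ⟨_, e1, _, e2, ?_⟩
      rw [listv_of_ne h5, h6, ← headI_listv, h7]
    | comp f g =>
      simp only [Sat, rule, Fm.eval, hJa, hJb, Fm.cond] at hs
      simp only [List.cons_append, List.nil_append, nav_cons, nav_nil, ne_eq] at *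
      obtain ⟨h1, h2, h3, h4, h5⟩ := hs
      have e1 := ha h1.1 g (hsub (by simp [subs, self_mem_subs])) h1.2
      have e2 := hb h3.1 f (hsub (by simp [subs, self_mem_subs])) h3.2
      rw [h2] at e1
      rw [h4, ← h5] at e2
      exact ev_comp.2 ⟨_, e1, e2⟩
    | case f g =>
      simp only [Sat, rule, Fm.eval, hJa, hJb, Fm.cond] at hs
      simp only [List.cons_append, List.nil_append, nav_cons, nav_nil, ne_eq] at *
      rcases hs with ⟨h0, h1, h2, h3⟩ | ⟨h0, h1, h2, h3, h4, h5⟩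
      · have e1 := ha h1.1 f (hsub (by simp [subs, self_mem_subs])) h1.2
        rw [h2, ← h3] at e1
        rw [ev_case_zero (by rw [headI_listv, h0]; rfl), tail_listv]
        exact e1
      · have e1 := ha h1.1 g (hsub (by simp [subs, self_mem_subs])) h1.2
        rw [listv_of_ne h2, ← h5, h3, h4] at e1
        rw [ev_case_succ (by rw [headI_listv, natv_of_ne h0]), tail_listv]
        exact e1
    | fix f =>
      simp only [Sat, rule, Fm.eval, hJa, hJb, Fm.cond] at hs
      simp only [List.cons_append, List.nil_append, nav_cons, nav_nil, ne_eq] at *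
      obtain ⟨h1, h2, h3⟩ := hs
      have e1 := ha h1.1 f (hsub (by simp [subs, self_mem_subs])) h1.2
      rw [h2] at e1
      rcases h3 with ⟨h0, h4⟩ | ⟨h0, h3, h4, h5⟩
      · have := ev_fix_inl e1 (by rw [headI_listv, h0]; rfl)
        rwa [tail_listv, ← h4] at this
      · have e2 := hb h3.1 _ hd h3.2
        rw [h4, ← h5, ← tail_listv] at e2
        exact ev_fix_inr e1 (by rw [headI_listv]; exact fun h => h0 (natv_eq_zero.1 h)) e2

/-- the judgment tree -/
def mk (i : ℕ) (v w : List ℕ) (a b : BT) : BT :=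
  node (node (node (num i) (node leaf a)) (node (lst w) b)) (lst v)

lemma good_num (c : Code) (k : ℕ) : Good (Phi c) (num k) := by
  induction k with
  | zero => exact good_leaf _
  | succ k ih =>
    refine good_node ?_ ih (good_leaf _)
    rw [sat_Phi]; left; simp

lemma good_lst (c : Code) (l : List ℕ) : Good (Phi c) (lst l) := by
  induction l with
  | nil => exact good_leaf _
  | cons k l ih =>
    refine good_node ?_ (good_num _ _) ih
    rw [sat_Phi]; left; simp

lemma good_mk (c d : Code) (hd : d ∈ subs c) (v w : List ℕ) (a b : BT)
    (ha : Good (Phi c) a) (hb : Good (Phi c) b)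
    (h : Sat child leaf (rule (cidx c) d) (mk (cidx c d) v w a b)) :
    Good (Phi c) (mk (cidx c d) v w a b) := by
  refine good_node ?_ (good_node ?_ (good_node ?_ (good_num _ _)
    (good_node ?_ (good_leaf _) ha)) (good_node ?_ (good_lst _ _) hb)) (good_lst _ _)
  · rw [sat_Phi]; right
    refine ⟨d, ?_, h⟩
    simpa using get_cidx hd
  all_goals rw [sat_Phi]; left; simp

lemma complete (c : Code) : ∀ d ∈ subs c, ∀ v w, Ev d v w →
    ∃ a b, Good (Phi c) (mk (cidx c d) v w a b) := by
  intro d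
  induction d with
  | zero' =>
    intro hd v w hw
    rw [ev_zero] at hw; subst hw
    refine ⟨leaf, leaf, good_mk c _ hd _ _ _ _ (good_leaf _) (good_leaf _) ?_⟩
    simp [Sat, rule, Fm.eval, mk]
  | succ =>
    intro hd v w hw
    rw [ev_succ] at hw; subst hw
    refine ⟨leaf, leaf, good_mk c _ hd _ _ _ _ (good_leaf _) (good_leaf _) ?_⟩
    simp [Sat, rule, Fm.eval, mk, lst]
  | tail =>
    intro hd v w hw
    rw [ev_tail] at hw; subst hw
    refine ⟨leaf, leaf, good_mk c _ hd _ _ _ _ (good_leaf _) (good_leaf _) ?_⟩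
    simp [Sat, rule, Fm.eval, mk]
  | cons f fs hf hfs =>
    intro hd v w hw
    rw [ev_cons] at hw
    obtain ⟨u, hu, z, hz, rfl⟩ := hw
    obtain ⟨a1, b1, g1⟩ := hf (subs_trans hd (by simp [subs, self_mem_subs])) _ _ hu
    obtain ⟨a2, b2, g2⟩ := hfs (subs_trans hd (by simp [subs, self_mem_subs])) _ _ hz
    refine ⟨_, _, good_mk c _ hd _ _ _ _ g1 g2 ?_⟩
    have hJa := fun J i => sat_isJ J pa i
    have hJb := fun J i => sat_isJ J pb i
    simp only [Sat] at hJa hJb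
    simp only [Sat, rule, Fm.eval, hJa, hJb]
    simp [mk]
  | comp f g hf hg =>
    intro hd v w hw
    rw [ev_comp] at hw
    obtain ⟨u, hu, hz⟩ := hw
    obtain ⟨a1, b1, g1⟩ := hg (subs_trans hd (by simp [subs, self_mem_subs])) _ _ hu
    obtain ⟨a2, b2, g2⟩ := hf (subs_trans hd (by simp [subs, self_mem_subs])) _ _ hz
    refine ⟨_, _, good_mk c _ hd _ _ _ _ g1 g2 ?_⟩
    have hJa := fun J i => sat_isJ J pa i
    have hJb := fun J i => sat_isJ J pb i
    simp only [Sat] at hJa hJb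
    simp only [Sat, rule, Fm.eval, hJa, hJb]
    simp [mk]
  | case f g hf hg =>
    intro hd v w hw
    have hJa := fun J i => sat_isJ J pa i
    simp only [Sat] at hJa
    rcases hv : v.headI with _ | m
    · rw [ev_case_zero hv] at hw
      obtain ⟨a1, b1, g1⟩ := hf (subs_trans hd (by simp [subs, self_mem_subs])) _ _ hw
      refine ⟨_, _, good_mk c _ hd _ _ _ _ g1 (good_leaf _) ?_⟩
      simp only [Sat, rule, Fm.eval, hJa, Fm.cond]
      simp [mk, hv]
    · rw [ev_case_succ hv] at hw
      obtain ⟨a1, b1, g1⟩ := hg (subs_trans hd (by simp [subs, self_mem_subs])) _ _ hw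
      refine ⟨_, _, good_mk c _ hd _ _ _ _ g1 (good_leaf _) ?_⟩
      simp only [Sat, rule, Fm.eval, hJa, Fm.cond]
      simp [mk, hv]
  | fix f hf =>
    intro hd v w hw
    have hJa := fun J i => sat_isJ J pa i
    have hJb := fun J i => sat_isJ J pb i
    simp only [Sat] at hJa hJb
    refine ev_fix_ind (fun v => ∃ a b, Good (Phi c) (mk (cidx c (.fix f)) v w a b)) ?_ ?_ hw
    · intro v u hu h0 he
      subst he
      obtain ⟨a1, b1, g1⟩ := hf (subs_trans hd (by simp [subs, self_mem_subs])) _ _ hu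
      refine ⟨_, _, good_mk c _ hd _ _ _ _ g1 (good_leaf _) ?_⟩
      simp only [Sat, rule, Fm.eval, hJa, hJb, Fm.cond]
      simp [mk, h0]
    · intro v u hu h0 hv'
      obtain ⟨a1, b1, g1⟩ := hf (subs_trans hd (by simp [subs, self_mem_subs])) _ _ hu
      obtain ⟨a2, b2, g2⟩ := hv'
      refine ⟨_, _, good_mk c _ hd _ _ _ _ g1 g2 ?_⟩
      simp only [Sat, rule, Fm.eval, hJa, hJb, Fm.cond]
      simp [mk, h0]

/-- Summary of the tree encoding. -/
theorem tree_iff (c : Code) (n : ℕ) :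
    (∃ t, Good (Phi c) t ∧ Sat child leaf (Phi0 c) t ∧ child true t = num (n + 1)) ↔
      (c.eval [n]).Dom := by
  constructor
  · rintro ⟨t, hG, h0, ht⟩
    rw [Phi0, sat_isJ] at h0
    have := sound c _ t le_rfl hG h0.1 c (self_mem_subs c) h0.2
    have e : listv (nav child pv t) = [n] := by
      simp [ht, num, listv]
    rw [e] at this
    exact this.fst
  · intro h
    obtain ⟨a, b, hG⟩ := complete c c (self_mem_subs c) _ _ (Part.get_mem h)
    refine ⟨_, hG, ?_, ?_⟩
    · rw [Phi0, sat_isJ]; simp [mk]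
    · simp [mk, lst, num]

end HeapUndec

namespace HeapUndec

open BT PreGraph

/-! ### Edge relations indexed by booleans -/

/-- `s1` and `s2` as one family -/
def sb {α : Type} (G : PreGraph α) : Bool → α → α → Prop
  | false => G.s1
  | true => G.s2

lemma isHom_iff {α β : Type} (G : PreGraph α) (G' : PreGraph β) (h : α → β) :
    IsHom G G' h ↔ (∀ x ∈ G.V, h x ∈ G'.V) ∧
      (∀ i x y, sb G i x y → sb G' i (h x) (h y)) ∧
      (∀ x ∈ G.V, (h x = G'.root ↔ x = G.root)) ∧
      (∀ x ∈ G.V, (h x = G'.null ↔ x = G.null)) := by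
  constructor
  · rintro ⟨a, b, c, d, e⟩
    refine ⟨a, ?_, d, e⟩
    intro i
    cases i
    · exact b
    · exact c
  · rintro ⟨a, b, d, e⟩
    exact ⟨a, b false, b true, d, e⟩

/-- A heap presented by successor functions. -/
structure HF {γ : Type} (H : PreGraph γ) (f : Bool → γ → γ) : Prop where
  sb_iff : ∀ i x y, sb H i x y ↔ x ∈ H.V ∧ y = f i x
  mem : ∀ i x, x ∈ H.V → f i x ∈ H.V
  nullV : H.null ∈ H.V
  rootV : H.root ∈ H.V
  ne : H.root ≠ H.null
  fnull : ∀ i, f i H.null = H.null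

lemma exists_HF {γ : Type} (H : PreGraph γ) (hH : IsHeap H) : ∃ f, HF H f := by
  classical
  obtain ⟨⟨_, hn, hr, hne, h1, h2, h3, h4⟩, t1, t2, _⟩ := hH
  have key : ∀ i, ∀ x ∈ H.V, ∃! y, sb H i x y := by
    intro i; cases i
    · exact t1
    · exact t2
  have kV : ∀ i x y, sb H i x y → x ∈ H.V ∧ y ∈ H.V := by
    intro i; cases i
    · exact h1
    · exact h2
  have kn : ∀ i, sb H i H.null H.null := by
    intro i; cases i
    · exact (h3 _).2 rfl
    · exact (h4 _).2 rfl
  let f : Bool → γ → γ := fun i x => if h : x ∈ H.V then (key i x h).choose else x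
  have fs : ∀ i x (h : x ∈ H.V), sb H i x (f i x) := by
    intro i x h
    simp only [f, dif_pos h]
    exact (key i x h).choose_spec.1
  refine ⟨f, ⟨?_, fun i x h => (kV i _ _ (fs i x h)).2, hn, hr, hne, ?_⟩⟩
  · intro i x y
    constructor
    · intro h
      exact ⟨(kV i _ _ h).1, (key i x (kV i _ _ h).1).unique h (fs i x (kV i _ _ h).1)⟩
    · rintro ⟨h, rfl⟩
      exact fs i x h
  · intro i
    exact (key i _ hn).unique (fs i _ hn) (kn i)

lemma HF.nav_null {γ : Type} {H : PreGraph γ} {f : Bool → γ → γ} (F : HF H f) (p : List Bool) :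
    nav f p H.null = H.null := by
  induction p with
  | nil => rfl
  | cons i p ih => rw [nav_cons, F.fnull, ih]

lemma HF.nav_mem {γ : Type} {H : PreGraph γ} {f : Bool → γ → γ} (F : HF H f) (p : List Bool) :
    ∀ x ∈ H.V, nav f p x ∈ H.V := by
  induction p with
  | nil => intro x h; exact h
  | cons i p ih => intro x h; exact ih _ (F.mem i x h)

/-! ### The second graph -/

inductive Flag : Type
  | off : Flag
  | left : Flag
  | right : Flag
  | here : Flag
  | start : Flag

instance : Finite Flag :=
  Finite.of_surjective (fun k : Fin 5 => match k with
    | 0 => Flag.off | 1 => Flag.left | 2 => Flag.right | 3 => Flag.here | 4 => Flag.start) (by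
    intro x
    cases x
    · exact ⟨0, rfl⟩
    · exact ⟨1, rfl⟩
    · exact ⟨2, rfl⟩
    · exact ⟨3, rfl⟩
    · exact ⟨4, rfl⟩)

def Flag.dir : Bool → Flag
  | false => Flag.left
  | true => Flag.right

def Flag.on : Flag → Prop
  | Flag.left => True
  | Flag.right => True
  | Flag.here => True
  | _ => False

abbrev W (K : ℕ) : Type := {l : List Bool // l.length ≤ K}

instance (K : ℕ) : Finite (W K) := (List.finite_length_le Bool K).to_subtype

abbrev Mid (K : ℕ) : Type := Set (W K) × Set (W K × W K) × Set (W K) × Flag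

abbrev Q (K : ℕ) : Type := Option (Option (Mid K))

def liftN {K : ℕ} (N : Set (W K)) (p : List Bool) : Prop := ∃ h, (⟨p, h⟩ : W K) ∈ N

def liftE {K : ℕ} (E : Set (W K × W K)) (p q : List Bool) : Prop :=
  ∃ h h', ((⟨p, h⟩, ⟨q, h'⟩) : W K × W K) ∈ E

structure Valid (φ ψ : Fm) {K : ℕ} (m : Mid K) : Prop where
  disj : ∀ r ∈ m.2.2.1, r ∉ m.1
  eqS : ∀ r ∈ m.2.2.1, ∀ r' ∈ m.2.2.1, (r, r') ∈ m.2.1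
  eqN : ∀ r ∈ m.1, ∀ r' ∈ m.1, (r, r') ∈ m.2.1
  closed : ∀ r ∈ m.1, ∀ i h, (⟨r.1 ++ [i], h⟩ : W K) ∈ m.1
  here : m.2.2.2 = Flag.here →
    (⟨[], Nat.zero_le _⟩ : W K) ∈ m.2.2.1 ∧ ¬ φ.eval (liftN m.1) (liftE m.2.1)
  start : m.2.2.2 = Flag.start →
    (⟨[], Nat.zero_le _⟩ : W K) ∈ m.2.2.1 ∧ ¬ ψ.eval (liftN m.1) (liftE m.2.1)

def step {K : ℕ} (i : Bool) (m : Mid K) : Q K → Prop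
  | none => (∀ r ∈ m.2.2.1, ∀ h, (⟨r.1 ++ [i], h⟩ : W K) ∈ m.1) ∧ m.2.2.2 ≠ Flag.dir i
  | some none => False
  | some (some m') => m'.1 = m.1 ∧ m'.2.1 = m.2.1 ∧
      (∀ r ∈ m.2.2.1, ∀ h, (⟨r.1 ++ [i], h⟩ : W K) ∈ m'.2.2.1) ∧
      (m.2.2.2 = Flag.dir i → m'.2.2.2.on)

def Qedge (φ ψ : Fm) (K : ℕ) (i : Bool) : Q K → Q K → Prop
  | none, y => y = none
  | some none, y => y ≠ some none ∧
      (i = false → ∃ m : Mid K, y = some (some m) ∧ m.2.2.2 ≠ Flag.off)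
  | some (some m), y => Valid φ ψ m ∧ step i m y

def QG (φ ψ : Fm) (K : ℕ) : PreGraph (Q K) where
  V := Set.univ
  s1 := Qedge φ ψ K false
  s2 := Qedge φ ψ K true
  null := none
  root := some none

lemma sb_QG (φ ψ : Fm) (K : ℕ) (i : Bool) : sb (QG φ ψ K) i = Qedge φ ψ K i := by
  cases i <;> rfl

/-- Any finite graph can be put on `Fin n`. -/
lemma exists_finGraph {α : Type} [Finite α] (P : PreGraph α) (hV : P.V = Set.univ)
    (hne : P.root ≠ P.null) (h1 : ∀ x, P.s1 P.null x ↔ x = P.null)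
    (h2 : ∀ x, P.s2 P.null x ↔ x = P.null) :
    ∃ G : FinGraph, ∀ (γ : Type) (H : PreGraph γ), Maps H G.toPreGraph ↔ Maps H P := by
  classical
  obtain ⟨n, ⟨e⟩⟩ := Finite.exists_equiv_fin α
  refine ⟨⟨n, fun x y => decide (P.s1 (e.symm x) (e.symm y)),
    fun x y => decide (P.s2 (e.symm x) (e.symm y)), e P.null, e P.root, ?_, ?_, ?_⟩, ?_⟩
  · simpa using hne
  · intro x; simp [h1, Equiv.symm_apply_eq]
  · intro x; simp [h2, Equiv.symm_apply_eq]
  · intro γ H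
    constructor
    · rintro ⟨h, a, b, c, d, f⟩
      refine ⟨fun x => e.symm (h x), fun x _ => by simp [hV], ?_, ?_, ?_, ?_⟩
      · intro x y hxy; simpa [FinGraph.toPreGraph] using b x y hxy
      · intro x y hxy; simpa [FinGraph.toPreGraph] using c x y hxy
      · intro x hx; rw [← d x hx]; simp [FinGraph.toPreGraph, Equiv.symm_apply_eq]
      · intro x hx; rw [← f x hx]; simp [FinGraph.toPreGraph, Equiv.symm_apply_eq]
    · rintro ⟨h, a, b, c, d, f⟩
      refine ⟨fun x => e (h x), fun x _ => by simp [FinGraph.toPreGraph], ?_, ?_, ?_, ?_⟩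
      · intro x y hxy; simpa [FinGraph.toPreGraph] using b x y hxy
      · intro x y hxy; simpa [FinGraph.toPreGraph] using c x y hxy
      · intro x hx; rw [← d x hx]; simp [FinGraph.toPreGraph]
      · intro x hx; rw [← f x hx]; simp [FinGraph.toPreGraph]

lemma exists_G2 (φ ψ : Fm) (K : ℕ) :
    ∃ G : FinGraph, ∀ (γ : Type) (H : PreGraph γ), Maps H G.toPreGraph ↔ Maps H (QG φ ψ K) :=
  exists_finGraph _ rfl (by simp [QG]) (fun _ => Iff.rfl) (fun _ => Iff.rfl)

/-- Constructing homomorphisms into the second graph. -/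
lemma maps_QG (φ ψ : Fm) (K : ℕ) (hφ : φ.bd ≤ K) (hψ : ψ.bd ≤ K) {γ : Type} {H : PreGraph γ}
    {f : Bool → γ → γ} (F : HF H f) (hroot : ∀ i, ∀ x ∈ H.V, f i x ≠ H.root)
    (x0 : γ) (fl : γ → Flag)
    (h1 : ∀ y ∈ H.V, fl y = Flag.here → y = x0 ∧ ¬ Sat f H.null φ x0)
    (h2 : ∀ y ∈ H.V, fl y = Flag.start → y = x0 ∧ ¬ Sat f H.null ψ x0)
    (h3 : ∀ i, ∀ y ∈ H.V, fl y = Flag.dir i → f i y ≠ H.null ∧ (fl (f i y)).on)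
    (h4 : f false H.root ≠ H.null) (h5 : fl (f false H.root) ≠ Flag.off) :
    Maps H (QG φ ψ K) := by
  classical
  let m : γ → Mid K := fun y =>
    ({r | nav f r.1 x0 = H.null}, {r | nav f r.1.1 x0 = nav f r.2.1 x0},
      {r | nav f r.1 x0 = y}, fl y)
  have hev : ∀ χ : Fm, χ.bd ≤ K → ∀ y, χ.eval (liftN (m y).1) (liftE (m y).2.1) →
      Sat f H.null χ x0 := by
    intro χ hχ y h
    refine Fm.eval_mono (K := K) ?_ ?_ χ hχ h
    · intro p hp
      exact ⟨fun ⟨_, h⟩ => h, fun h => ⟨hp, h⟩⟩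
    · rintro p q hp hq ⟨_, _, h⟩
      exact h
  have hval : ∀ y ∈ H.V, y ≠ H.null → Valid φ ψ (m y) := by
    intro y hy hn
    refine ⟨?_, ?_, ?_, ?_, ?_, ?_⟩
    · intro r hr hr'
      have a : nav f r.1 x0 = y := hr
      have b : nav f r.1 x0 = H.null := hr'
      exact hn (a.symm.trans b)
    · intro r hr r' hr'
      have a : nav f r.1 x0 = y := hr
      have b : nav f r'.1 x0 = y := hr'
      exact a.trans b.symm
    · intro r hr r' hr'
      have a : nav f r.1 x0 = H.null := hr
      have b : nav f r'.1 x0 = H.null := hr'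
      exact a.trans b.symm
    · intro r hr i h
      have a : nav f r.1 x0 = H.null := hr
      change nav f (r.1 ++ [i]) x0 = H.null
      rw [nav_append, a, F.nav_null]
    · intro hfl
      obtain ⟨a, b⟩ := h1 y hy hfl
      exact ⟨a.symm, fun h => b (hev φ hφ y h)⟩
    · intro hfl
      obtain ⟨a, b⟩ := h2 y hy hfl
      exact ⟨a.symm, fun h => b (hev ψ hψ y h)⟩
  let h : γ → Q K := fun y => if y = H.null then none else if y = H.root then some none else
    some (some (m y))
  have hnull : h H.null = none := by simp [h]
  have hrt : h H.root = some none := by simp [h, F.ne]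
  have hmid : ∀ y, y ≠ H.null → y ≠ H.root → h y = some (some (m y)) := by
    intro y a b; simp [h, a, b]
  refine ⟨h, (isHom_iff _ _ _).2 ⟨fun _ _ => trivial, ?_, ?_, ?_⟩⟩
  · intro i x y hxy
    rw [F.sb_iff] at hxy
    obtain ⟨hx, rfl⟩ := hxy
    rw [sb_QG]
    by_cases hxn : x = H.null
    · rw [hxn, F.fnull, hnull]; rfl
    by_cases hxr : x = H.root
    · subst hxr
      rw [hrt]
      refine ⟨?_, ?_⟩
      · by_cases hn : f i H.root = H.null
        · rw [hn, hnull]; simp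
        · rw [hmid _ hn (hroot i _ hx)]; simp
      · rintro rfl
        exact ⟨_, hmid _ h4 (hroot _ _ hx), h5⟩
    rw [hmid x hxn hxr]
    refine ⟨hval x hx hxn, ?_⟩
    have hs : ∀ r ∈ (m x).2.2.1, nav f (r.1 ++ [i]) x0 = f i x := by
      intro r hr
      have a : nav f r.1 x0 = x := hr
      rw [nav_append, a]; rfl
    by_cases hn : f i x = H.null
    · rw [hn, hnull]
      refine ⟨fun r hr hb => (hs r hr).trans hn, fun hfl => (h3 i x hx hfl).1 hn⟩
    · rw [hmid _ hn (hroot i _ hx)]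
      exact ⟨rfl, rfl, fun r hr hb => hs r hr, fun hfl => (h3 i x hx hfl).2⟩
  · intro x hx
    change h x = some none ↔ _
    by_cases hxn : x = H.null
    · rw [hxn, hnull]; simp [F.ne.symm]
    by_cases hxr : x = H.root
    · simp [hxr, hrt]
    · simp [hmid x hxn hxr, hxr]
  · intro x hx
    change h x = none ↔ _
    by_cases hxn : x = H.null
    · rw [hxn, hnull]; simp
    by_cases hxr : x = H.root
    · simp [hxr, hrt, F.ne]
    · simp [hmid x hxn hxr, hxn]

/-! ### Unfolding of acyclic heaps -/

inductive Unf {γ : Type} (f : Bool → γ → γ) (z : γ) : γ → BT → Prop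
  | null : Unf f z z leaf
  | node (x : γ) (a b : BT) : x ≠ z → Unf f z (f false x) a → Unf f z (f true x) b →
      Unf f z x (node a b)

lemma Unf.fn {γ : Type} {f : Bool → γ → γ} {z : γ} {x : γ} {s : BT} (h : Unf f z x s) :
    ∀ {t : BT}, Unf f z x t → s = t := by
  induction h with
  | null =>
    intro t ht
    cases ht with
    | null => rfl
    | node _ _ _ h => exact absurd rfl h
  | node x a b hx _ _ iha ihb =>
    intro t ht
    cases ht with
    | null => exact absurd rfl hx
    | node _ a' b' _ h1 h2 => rw [iha h1, ihb h2]

lemma Unf.leaf_iff {γ : Type} {f : Bool → γ → γ} {z : γ} {x : γ} {s : BT} (h : Unf f z x s) :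
    x = z ↔ s = leaf := by
  cases h with
  | null => simp
  | node _ _ _ h => simp [h]

lemma Unf.child {γ : Type} {f : Bool → γ → γ} {z : γ} (hz : ∀ i, f i z = z) {x : γ} {s : BT}
    (h : Unf f z x s) (i : Bool) : Unf f z (f i x) (child i s) := by
  cases h with
  | null => rw [hz, child_leaf]; exact Unf.null
  | node _ _ _ _ h1 h2 => cases i <;> assumption

lemma Unf.nav {γ : Type} {f : Bool → γ → γ} {z : γ} (hz : ∀ i, f i z = z) (p : List Bool) :
    ∀ {x : γ} {s : BT}, Unf f z x s → Unf f z (nav f p x) (nav BT.child p s) := by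
  induction p with
  | nil => intro x s h; exact h
  | cons i p ih => intro x s h; exact ih (h.child hz i)

lemma Unf.sat {γ : Type} {f : Bool → γ → γ} {z : γ} (hz : ∀ i, f i z = z) {x : γ} {s : BT}
    (h : Unf f z x s) {φ : Fm} (hs : Sat f z φ x) : Sat BT.child leaf φ s := by
  refine Fm.eval_mono (K := φ.bd) ?_ ?_ φ le_rfl hs
  · intro p _; exact (h.nav hz p).leaf_iff
  · intro p q _ _ e
    have a := h.nav hz p
    rw [e] at a
    exact a.fn (h.nav hz q)

/-- A heap that does not map to the second graph unfolds to a good tree. -/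
lemma unfold_heap (φ ψ : Fm) (K : ℕ) (hφ : φ.bd ≤ K) (hψ : ψ.bd ≤ K) {γ : Type} {H : PreGraph γ}
    {f : Bool → γ → γ} (F : HF H f) (hroot : ∀ i, ∀ x ∈ H.V, f i x ≠ H.root)
    (h4 : f false H.root ≠ H.null) (hno : ¬ Maps H (QG φ ψ K)) :
    ∃ t, Unf f H.null (f false H.root) t ∧ Good φ t ∧ Sat BT.child leaf ψ t := by
  classical
  have key := fun x0 fl h1 h2 h3 h5 =>
    hno (maps_QG φ ψ K hφ hψ F hroot x0 fl h1 h2 h3 h4 h5)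
  have hMV : f false H.root ∈ H.V := F.mem _ _ F.rootV
  -- existence of the unfolding
  have F3 : ∃ t, Unf f H.null (f false H.root) t := by
    by_contra hcon
    refine key H.null (fun y => if ∃ t, Unf f H.null y t then Flag.off else
      if ∃ t, Unf f H.null (f false y) t then Flag.right else Flag.left) ?_ ?_ ?_ ?_
    · intro y _ h; split_ifs at h
    · intro y _ h; split_ifs at h
    · intro i y _ h
      have hx : ∀ y, (¬ ∃ t, Unf f H.null y t) → y ≠ H.null ∧
        Flag.on (if ∃ t, Unf f H.null y t then Flag.off else
          if ∃ t, Unf f H.null (f false y) t then Flag.right else Flag.left) := by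
        intro y hy
        refine ⟨?_, ?_⟩
        · rintro rfl; exact hy ⟨_, Unf.null⟩
        · rw [if_neg hy]; split_ifs <;> trivial
      split_ifs at h with ha hb
      · cases i <;> cases h
      · cases i
        · cases h
        · refine hx _ ?_
          rintro ⟨b, hb'⟩
          obtain ⟨a, ha'⟩ := hb
          exact ha ⟨_, Unf.node _ _ _ (hx _ ha).1 ha' hb'⟩
      · cases i
        · exact hx _ hb
        · cases h
    · rw [if_neg hcon]; split_ifs <;> simp
  obtain ⟨t, ht⟩ := F3
  have F1 : ∀ p, nav f p (f false H.root) ≠ H.null →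
      Sat f H.null φ (nav f p (f false H.root)) := by
    intro p hp
    by_contra hcon
    generalize hx : nav f p (f false H.root) = x at hp hcon
    let R : γ → Prop := fun y => ∃ q, nav f q y = x
    let fl : γ → Flag := fun y => if y = x then Flag.here else
      if R (f false y) then Flag.left else if R (f true y) then Flag.right else Flag.off
    have hR : ∀ y, R y → y ≠ H.null ∧ (fl y).on := by
      rintro y ⟨q, hq⟩
      refine ⟨?_, ?_⟩
      · rintro rfl; exact hp (hq.symm.trans (F.nav_null q))
      · match q, hq with
        | [], hq => simp only [fl, if_pos (show y = x from hq)]; trivial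
        | false :: q, hq =>
          have : R (f false y) := ⟨q, hq⟩
          simp only [fl, if_pos this]; split_ifs <;> trivial
        | true :: q, hq =>
          have : R (f true y) := ⟨q, hq⟩
          simp only [fl, if_pos this]; split_ifs <;> trivial
    refine key x fl ?_ ?_ ?_ ?_
    · intro y _ h
      simp only [fl] at h
      split_ifs at h with h1
      exact ⟨h1, hcon⟩
    · intro y _ h; simp only [fl] at h; split_ifs at h
    · intro i y _ h
      have hi : R (f i y) := by
        simp only [fl] at h
        cases i <;> split_ifs at h <;> first | assumption | cases h
      exact hR _ hi
    · intro h
      have := (hR _ ⟨p, hx⟩).2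
      rw [h] at this
      exact this
  have F2 : Sat f H.null ψ (f false H.root) := by
    by_contra hcon
    refine key (f false H.root)
      (fun y => if y = f false H.root then Flag.start else Flag.off) ?_ ?_ ?_ ?_
    · intro y _ h; split_ifs at h
    · intro y _ h
      split_ifs at h with h1
      exact ⟨h1, hcon⟩
    · intro i y _ h
      split_ifs at h <;> cases i <;> cases h
    · simp
  refine ⟨t, ht, ?_, ht.sat F.fnull F2⟩
  intro p hp
  have hu := ht.nav F.fnull p
  exact hu.sat F.fnull (F1 p (fun h => hp (hu.leaf_iff.1 h)))

end HeapUndec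

namespace HeapUndec

/-! ### The first graph and its code -/

def e1 (n i j : ℕ) : Bool :=
  (decide (i ≤ n + 1) && decide (j = i - 1)) ||
  (decide (n + 2 ≤ i) && (decide (i ≤ n + 3) && decide (j ≤ n + 2))) ||
  (decide (i = n + 4) && decide (j = n + 3))

def e2 (n i j : ℕ) : Bool :=
  (decide (i ≤ n + 1) && decide (j = 0)) ||
  (decide (i = n + 2) && decide (j ≤ n + 2)) ||
  ((decide (i = n + 3) && decide (j = n + 1)) ||
  (decide (i = n + 4) && decide (j = 0)))

def G1 (n : ℕ) : FinGraph where
  n := n + 5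
  s1 := fun i j => e1 n i.1 j.1
  s2 := fun i j => e2 n i.1 j.1
  null := ⟨0, by omega⟩
  root := ⟨n + 4, by omega⟩
  root_ne_null := by simp [Fin.ext_iff]
  null_s1 := by
    intro x
    simp only [e1, Fin.ext_iff, Bool.or_eq_true, Bool.and_eq_true, decide_eq_true_eq]
    omega
  null_s2 := by
    intro x
    simp only [e2, Fin.ext_iff, Bool.or_eq_true, Bool.and_eq_true, decide_eq_true_eq]
    omega

lemma encode_fn {α : Type} [Encodable α] {n : ℕ} (f : Fin n → α) :
    Encodable.encode f =
      Encodable.encode (List.ofFn fun i : Fin n => Nat.pair i.1 (Encodable.encode (f i))) := by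
  have h1 : Encodable.encode f =
      Encodable.encode (List.ofFn fun i : Fin n => (⟨i, f i⟩ : Σ _ : Fin n, α)) := by
    change Encodable.encode (List.Vector.ofFn fun i : Fin n => (⟨i, f i⟩ : Σ _ : Fin n, α)).1 = _
    congr 1
    exact List.Vector.toList_ofFn _
  have h2 : ∀ {β : Type} [Encodable β] (l : List β),
      Encodable.encode l = Encodable.encode (l.map Encodable.encode) := by
    intro β _ l
    induction l with
    | nil => rfl
    | cons a l ih => simp [Encodable.encode_list_cons, ih]
  rw [h1, h2, List.map_ofFn]
  rfl

lemma ofFn_eq_range {α : Type} (n : ℕ) (g : ℕ → α) :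
    (List.ofFn fun i : Fin n => g i.1) = (List.range n).map g := by
  apply List.ext_getElem <;> simp

def rowCode (m : ℕ) (g : ℕ → Bool) : ℕ :=
  Encodable.encode ((List.range m).map fun j => Nat.pair j (Encodable.encode (g j)))

def gridCode (m : ℕ) (g : ℕ → ℕ → Bool) : ℕ :=
  Encodable.encode ((List.range m).map fun i => Nat.pair i (rowCode m (g i)))

lemma encode_grid (m : ℕ) (g : ℕ → ℕ → Bool) :
    Encodable.encode (fun i j : Fin m => g i.1 j.1) = gridCode m g := by
  have hrow : ∀ i : ℕ, Encodable.encode (fun j : Fin m => g i j.1) = rowCode m (g i) := by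
    intro i
    rw [encode_fn, ofFn_eq_range m (fun j => Nat.pair j (Encodable.encode (g i j)))]
    rfl
  rw [encode_fn]
  simp only [hrow]
  rw [ofFn_eq_range m (fun i => Nat.pair i (rowCode m (g i)))]
  rfl

lemma encode_G1 (n : ℕ) : (G1 n).encode =
    Nat.pair (n + 5) (Nat.pair (gridCode (n + 5) (e1 n)) (Nat.pair (gridCode (n + 5) (e2 n))
      (Nat.pair 0 (n + 4)))) := by
  have h : (G1 n).encode = Nat.pair (Encodable.encode (n + 5))
      (Encodable.encode (((fun i j : Fin (n + 5) => e1 n i.1 j.1),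
        (fun i j : Fin (n + 5) => e2 n i.1 j.1), (⟨0, by omega⟩ : Fin (n + 5)),
        (⟨n + 4, by omega⟩ : Fin (n + 5))) :
        (Fin (n + 5) → Fin (n + 5) → Bool) × (Fin (n + 5) → Fin (n + 5) → Bool) ×
          Fin (n + 5) × Fin (n + 5))) := by
    rw [FinGraph.encode]
    exact Encodable.encode_sigma_val _ _
  rw [h, Encodable.encode_prod_val, Encodable.encode_prod_val, Encodable.encode_prod_val,
    encode_grid, encode_grid, Encodable.encode_nat]
  rfl

lemma grid_primrec {e : ℕ → ℕ → ℕ → Bool} (he : Primrec fun p : (ℕ × ℕ) × ℕ => e p.1.1 p.1.2 p.2) :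
    Primrec fun n => gridCode (n + 5) (e n) := by
  have hrow : Primrec fun p : ℕ × ℕ => rowCode (p.1 + 5) (e p.1 p.2) := by
    refine Primrec.encode.comp (Primrec.list_map ?_ ?_)
    · exact Primrec.list_range.comp (Primrec.nat_add.comp Primrec.fst (Primrec.const 5))
    · exact Primrec₂.natPair.comp Primrec.snd (Primrec.encode.comp he)
  refine Primrec.encode.comp (Primrec.list_map ?_ ?_)
  · exact Primrec.list_range.comp (Primrec.nat_add.comp Primrec.id (Primrec.const 5))
  · exact Primrec₂.natPair.comp Primrec.snd hrow

lemma e1_primrec : Primrec fun p : (ℕ × ℕ) × ℕ => e1 p.1.1 p.1.2 p.2 := by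
  have hn : Primrec fun p : (ℕ × ℕ) × ℕ => p.1.1 := Primrec.fst.comp Primrec.fst
  have hi : Primrec fun p : (ℕ × ℕ) × ℕ => p.1.2 := Primrec.snd.comp Primrec.fst
  have hj : Primrec fun p : (ℕ × ℕ) × ℕ => p.2 := Primrec.snd
  have hk : ∀ k : ℕ, Primrec fun p : (ℕ × ℕ) × ℕ => p.1.1 + k :=
    fun k => Primrec.nat_add.comp hn (Primrec.const k)
  have hi1 : Primrec fun p : (ℕ × ℕ) × ℕ => p.1.2 - 1 := Primrec.nat_sub.comp hi (Primrec.const 1)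
  have hle : ∀ {a b : (ℕ × ℕ) × ℕ → ℕ}, Primrec a → Primrec b →
      Primrec fun p => decide (a p ≤ b p) := fun ha hb => (Primrec.nat_le.comp ha hb).decide
  have heq : ∀ {a b : (ℕ × ℕ) × ℕ → ℕ}, Primrec a → Primrec b →
      Primrec fun p => decide (a p = b p) := fun ha hb => (Primrec.eq.comp ha hb).decide
  exact Primrec.or.comp (Primrec.or.comp
    (Primrec.and.comp (hle hi (hk 1)) (heq hj hi1))
    (Primrec.and.comp (hle (hk 2) hi) (Primrec.and.comp (hle hi (hk 3)) (hle hj (hk 2)))))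
    (Primrec.and.comp (heq hi (hk 4)) (heq hj (hk 3)))

lemma e2_primrec : Primrec fun p : (ℕ × ℕ) × ℕ => e2 p.1.1 p.1.2 p.2 := by
  have hn : Primrec fun p : (ℕ × ℕ) × ℕ => p.1.1 := Primrec.fst.comp Primrec.fst
  have hi : Primrec fun p : (ℕ × ℕ) × ℕ => p.1.2 := Primrec.snd.comp Primrec.fst
  have hj : Primrec fun p : (ℕ × ℕ) × ℕ => p.2 := Primrec.snd
  have hk : ∀ k : ℕ, Primrec fun p : (ℕ × ℕ) × ℕ => p.1.1 + k :=
    fun k => Primrec.nat_add.comp hn (Primrec.const k)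
  have h0 : Primrec fun _ : (ℕ × ℕ) × ℕ => 0 := Primrec.const 0
  have hle : ∀ {a b : (ℕ × ℕ) × ℕ → ℕ}, Primrec a → Primrec b →
      Primrec fun p => decide (a p ≤ b p) := fun ha hb => (Primrec.nat_le.comp ha hb).decide
  have heq : ∀ {a b : (ℕ × ℕ) × ℕ → ℕ}, Primrec a → Primrec b →
      Primrec fun p => decide (a p = b p) := fun ha hb => (Primrec.eq.comp ha hb).decide
  exact Primrec.or.comp (Primrec.or.comp
    (Primrec.and.comp (hle hi (hk 1)) (heq hj h0))
    (Primrec.and.comp (heq hi (hk 2)) (hle hj (hk 2))))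
    (Primrec.or.comp (Primrec.and.comp (heq hi (hk 3)) (heq hj (hk 1)))
    (Primrec.and.comp (heq hi (hk 4)) (heq hj h0)))

lemma encode_G1_primrec : Primrec fun n => (G1 n).encode := by
  have hk : ∀ k : ℕ, Primrec fun n : ℕ => n + k :=
    fun k => Primrec.nat_add.comp Primrec.id (Primrec.const k)
  refine Primrec.of_eq ?_ (fun n => (encode_G1 n).symm)
  exact Primrec₂.natPair.comp (hk 5) (Primrec₂.natPair.comp (grid_primrec e1_primrec)
    (Primrec₂.natPair.comp (grid_primrec e2_primrec)
      (Primrec₂.natPair.comp (Primrec.const 0) (hk 4))))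

lemma encode_inj {G G' : FinGraph} (h : G.encode = G'.encode) : G = G' := by
  obtain ⟨n, a, b, c, d, _, _, _⟩ := G
  obtain ⟨n', a', b', c', d', _, _, _⟩ := G'
  have h' := Encodable.encode_injective h
  cases h'
  rfl

lemma encodePair_inj {G G' K K' : FinGraph} (h : encodePair G K = encodePair G' K') :
    G = G' ∧ K = K' := by
  have := Nat.pair_eq_pair.1 h
  exact ⟨encode_inj this.1, encode_inj this.2⟩

/-- A code for the halting problem. -/
lemma exists_universal : ∃ c : Turing.ToPartrec.Code,
    ∀ n, (c.eval [n]).Dom ↔ (Nat.Partrec.Code.eval (Denumerable.ofNat Nat.Partrec.Code n) 0).Dom := by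
  have hf : Partrec fun n : ℕ => Nat.Partrec.Code.eval (Denumerable.ofNat Nat.Partrec.Code n) 0 :=
    Nat.Partrec.Code.eval_part.comp (Computable.ofNat _) (Computable.const 0)
  have h1 := Nat.Partrec'.part_iff₁.2 hf
  obtain ⟨c, hc⟩ := Turing.ToPartrec.Code.exists_code h1
  refine ⟨c, fun n => ?_⟩
  have := hc (n ::ᵥ List.Vector.nil)
  have e : c.eval [n] =
    pure <$> Nat.Partrec.Code.eval (Denumerable.ofNat Nat.Partrec.Code n) 0 := this
  rw [e]
  rfl

/-- The final reduction. -/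
lemma reduction (G2 : FinGraph) (c : Turing.ToPartrec.Code)
    (hc : ∀ n, (c.eval [n]).Dom ↔
      (Nat.Partrec.Code.eval (Denumerable.ofNat Nat.Partrec.Code n) 0).Dom)
    (h : ∀ n, ¬ HeapImplies (G1 n).toPreGraph G2.toPreGraph ↔ (c.eval [n]).Dom) :
    ¬ ComputablePred (fun m : ℕ =>
      ∃ G1 G2 : FinGraph, m = encodePair G1 G2 ∧
        HeapImplies G1.toPreGraph G2.toPreGraph) := by
  intro hP
  apply ComputablePred.halting_problem 0
  have hf : Computable fun d : Nat.Partrec.Code =>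
      encodePair (G1 (Encodable.encode d)) G2 := by
    exact (Primrec₂.natPair.comp (encode_G1_primrec.comp Primrec.encode)
      (Primrec.const _)).to_comp
  have h2 := (ComputablePred.computable_iff.1 hP)
  obtain ⟨g, hg, hge⟩ := h2
  have h3 : ComputablePred fun d : Nat.Partrec.Code =>
      (g (encodePair (G1 (Encodable.encode d)) G2) : Prop) :=
    ComputablePred.computable_iff.2 ⟨_, hg.comp hf, rfl⟩
  refine ComputablePred.of_eq h3.not ?_
  intro d
  have h4 := congrFun hge (encodePair (G1 (Encodable.encode d)) G2)
  rw [← h4]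
  have h5 : (∃ G1' G2' : FinGraph, encodePair (G1 (Encodable.encode d)) G2 = encodePair G1' G2' ∧
        HeapImplies G1'.toPreGraph G2'.toPreGraph) ↔
      HeapImplies (G1 (Encodable.encode d)).toPreGraph G2.toPreGraph := by
    constructor
    · rintro ⟨a, b, hab, hi⟩
      obtain ⟨rfl, rfl⟩ := encodePair_inj hab
      exact hi
    · intro hi
      exact ⟨_, _, rfl, hi⟩
  have h6 := (not_congr h5).trans ((h _).trans (hc _))
  rw [Denumerable.ofNat_encode] at h6
  exact h6

end HeapUndec

namespace HeapUndec

open BT PreGraph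

/-! ### From heaps to trees -/

lemma heap_to_tree (φ ψ : Fm) (K : ℕ) (hφ : φ.bd ≤ K) (hψ : ψ.bd ≤ K) (n : ℕ) {γ : Type}
    {H : PreGraph γ} (hH : IsHeap H) (hm : Maps H (G1 n).toPreGraph)
    (hno : ¬ Maps H (QG φ ψ K)) :
    ∃ t, Good φ t ∧ Sat BT.child leaf ψ t ∧ BT.child true t = num (n + 1) := by
  obtain ⟨f, F⟩ := exists_HF H hH
  obtain ⟨g, hg⟩ := hm
  obtain ⟨-, g1, g2, g3, g4⟩ := hg
  have ge1 : ∀ x ∈ H.V, e1 n (g x).1 (g (f false x)).1 = true :=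
    fun x hx => g1 _ _ ((F.sb_iff false _ _).2 ⟨hx, rfl⟩)
  have ge2 : ∀ x ∈ H.V, e2 n (g x).1 (g (f true x)).1 = true :=
    fun x hx => g2 _ _ ((F.sb_iff true _ _).2 ⟨hx, rfl⟩)
  simp only [e1, e2, Bool.or_eq_true, Bool.and_eq_true, decide_eq_true_eq] at ge1 ge2
  have gr : ∀ x ∈ H.V, (g x).1 = n + 4 ↔ x = H.root := by
    intro x hx
    rw [← g3 x hx]
    exact (Fin.ext_iff (b := (G1 n).root)).symm
  have gn : ∀ x ∈ H.V, (g x).1 = 0 ↔ x = H.null := by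
    intro x hx
    rw [← g4 x hx]
    exact (Fin.ext_iff (b := (G1 n).null)).symm
  have hroot : ∀ i, ∀ x ∈ H.V, f i x ≠ H.root := by
    intro i x hx h
    have h1 := (gr _ (F.mem i x hx)).2 h
    cases i
    · have := ge1 x hx; omega
    · have := ge2 x hx; omega
  have r4 := (gr _ F.rootV).2 rfl
  have hM : (g (f false H.root)).1 = n + 3 := by
    have := ge1 _ F.rootV; omega
  have hMV := F.mem false _ F.rootV
  have h4 : f false H.root ≠ H.null := by
    intro h
    have := (gn _ hMV).2 h
    omega
  have hA : (g (f true (f false H.root))).1 = n + 1 := by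
    have := ge2 _ hMV; omega
  have hunf : ∀ k, k ≤ n + 1 → ∀ x ∈ H.V, (g x).1 = k → Unf f H.null x (num k) := by
    intro k
    induction k with
    | zero =>
      intro _ x hx h
      rw [(gn x hx).1 h]
      exact Unf.null
    | succ k ih =>
      intro hk x hx h
      refine Unf.node _ _ _ ?_ ?_ ?_
      · intro h'
        have := (gn x hx).2 h'
        omega
      · refine ih (by omega) _ (F.mem _ _ hx) ?_
        have := ge1 x hx; omega
      · have h0 : (g (f true x)).1 = 0 := by have := ge2 x hx; omega
        rw [(gn _ (F.mem _ _ hx)).1 h0]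
        exact Unf.null
  obtain ⟨t, ht, hG, hS⟩ := unfold_heap φ ψ K hφ hψ F hroot h4 hno
  refine ⟨t, hG, hS, ?_⟩
  exact (ht.child F.fnull true).fn (hunf (n + 1) le_rfl _ (F.mem _ _ hMV) hA)

/-! ### From trees to heaps -/

def subt (r : BT) : Set BT := {x | ∃ p, nav BT.child p r = x}

lemma subt_self (r : BT) : r ∈ subt r := ⟨[], rfl⟩

lemma subt_child {r x : BT} (h : x ∈ subt r) (i : Bool) : BT.child i x ∈ subt r := by
  obtain ⟨p, rfl⟩ := h
  exact ⟨p ++ [i], by rw [nav_append]; rfl⟩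

lemma subt_size {r x : BT} (h : x ∈ subt r) : size x ≤ size r := by
  obtain ⟨p, rfl⟩ := h
  exact size_nav_le p r

lemma subt_cases {a b x : BT} (h : x ∈ subt (node a b)) :
    x = node a b ∨ x ∈ subt a ∨ x ∈ subt b := by
  obtain ⟨p, rfl⟩ := h
  match p with
  | [] => exact Or.inl rfl
  | false :: p => exact Or.inr (Or.inl ⟨p, rfl⟩)
  | true :: p => exact Or.inr (Or.inr ⟨p, rfl⟩)

lemma subt_leaf_eq {x : BT} (h : x ∈ subt leaf) : x = leaf := by
  obtain ⟨p, rfl⟩ := h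
  exact nav_leaf p

lemma subt_finite (r : BT) : (subt r).Finite := by
  induction r with
  | leaf => exact (Set.finite_singleton leaf).subset fun x hx => subt_leaf_eq hx
  | node a b iha ihb =>
    refine ((Set.finite_singleton (node a b)).union (iha.union ihb)).subset ?_
    intro x hx
    exact subt_cases hx

lemma leaf_mem_subt (r : BT) : leaf ∈ subt r := by
  induction r with
  | leaf => exact subt_self _
  | node a b iha _ =>
    obtain ⟨p, hp⟩ := iha
    exact ⟨false :: p, hp⟩

def TH (r : BT) : PreGraph BT where
  V := subt r
  s1 := fun x y => x ∈ subt r ∧ y = BT.child false x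
  s2 := fun x y => x ∈ subt r ∧ y = BT.child true x
  null := leaf
  root := r

lemma TH_heap (r : BT) (hr : r ≠ leaf) : IsHeap (TH r) := by
  refine ⟨⟨subt_finite r, leaf_mem_subt r, subt_self r, hr, ?_, ?_, ?_, ?_⟩, ?_, ?_, ?_⟩
  · rintro x y ⟨h, rfl⟩; exact ⟨h, subt_child h _⟩
  · rintro x y ⟨h, rfl⟩; exact ⟨h, subt_child h _⟩
  · intro x; exact ⟨fun h => h.2, fun h => ⟨leaf_mem_subt r, h⟩⟩
  · intro x; exact ⟨fun h => h.2, fun h => ⟨leaf_mem_subt r, h⟩⟩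
  · intro x hx; exact ⟨_, ⟨hx, rfl⟩, fun y h => h.2⟩
  · intro x hx; exact ⟨_, ⟨hx, rfl⟩, fun y h => h.2⟩
  · rintro x ⟨p, rfl⟩ -
    induction p using List.reverseRecOn with
    | nil => exact Relation.ReflTransGen.refl
    | append_singleton p i ih =>
      refine ih.tail ?_
      rw [nav_append]
      cases i
      · exact Or.inl ⟨⟨p, rfl⟩, rfl⟩
      · exact Or.inr ⟨⟨p, rfl⟩, rfl⟩

lemma num_inj : ∀ {j k : ℕ}, num j = num k → j = k
  | 0, k, h => ((num_eq_leaf k).1 h.symm).symm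
  | j + 1, 0, h => by cases h
  | j + 1, k + 1, h => by
    have : num j = num k := by injection h
    rw [num_inj this]

lemma TH_maps (n : ℕ) (t : BT) (ht : BT.child true t = num (n + 1)) :
    Maps (TH (node t leaf)) (G1 n).toPreGraph := by
  classical
  have htl : t ≠ leaf := by
    rintro rfl
    have := (num_eq_leaf (n + 1)).1 ht.symm
    omega
  have htn : ∀ k, num k ≠ t := by
    rintro k rfl
    rw [num_true] at ht
    have := (num_eq_leaf (n + 1)).1 ht.symm
    omega
  have hrn : ∀ k, num k ≠ node t leaf := by
    intro k h
    have := congrArg (BT.child false) h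
    rw [num_false] at this
    exact htn _ this
  have htr : t ≠ node t leaf := by
    intro h
    have := congrArg size h
    simp only [size] at this
    omega
  let g : BT → ℕ := fun x => if x = node t leaf then n + 4 else if x = t then n + 3 else
    if h : ∃ k, k ≤ n + 1 ∧ num k = x then h.choose else n + 2
  have gr : g (node t leaf) = n + 4 := if_pos rfl
  have gt : g t = n + 3 := (if_neg htr).trans (if_pos rfl)
  have gnum : ∀ k, k ≤ n + 1 → g (num k) = k := by
    intro k hk
    have h : ∃ j, j ≤ n + 1 ∧ num j = num k := ⟨k, hk, rfl⟩
    simp only [g]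
    rw [if_neg (hrn k), if_neg (htn k), dif_pos h]
    exact num_inj h.choose_spec.2
  have gany : ∀ x, x ≠ node t leaf → x ≠ t → (¬ ∃ k, k ≤ n + 1 ∧ num k = x) → g x = n + 2 := by
    intro x h1 h2 h3
    simp only [g]
    rw [if_neg h1, if_neg h2, dif_neg h3]
  have gle : ∀ x, x ≠ node t leaf → x ≠ t → g x ≤ n + 2 := by
    intro x h1 h2
    by_cases h : ∃ k, k ≤ n + 1 ∧ num k = x
    · obtain ⟨k, hk, rfl⟩ := h
      rw [gnum k hk]; omega
    · exact (gany x h1 h2 h).le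
  have gleaf : g leaf = 0 := gnum 0 (by omega)
  have g0 : ∀ x, g x = 0 → x = leaf := by
    intro x h
    by_cases h1 : x = node t leaf
    · rw [h1, gr] at h; omega
    by_cases h2 : x = t
    · rw [h2, gt] at h; omega
    by_cases h3 : ∃ k, k ≤ n + 1 ∧ num k = x
    · obtain ⟨k, hk, rfl⟩ := h3
      rw [gnum k hk] at h
      rw [h]; rfl
    · rw [gany x h1 h2 h3] at h; omega
  have g4 : ∀ x, g x = n + 4 → x = node t leaf := by
    intro x h
    by_contra h1
    by_cases h2 : x = t
    · rw [h2, gt] at h; omega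
    · have := gle x h1 h2; omega
  have glt : ∀ x, g x < n + 5 := by
    intro x
    by_cases h1 : x = node t leaf
    · rw [h1, gr]; omega
    by_cases h2 : x = t
    · rw [h2, gt]; omega
    have := gle x h1 h2
    omega
  have hsz : ∀ x ∈ subt (node t leaf), x ≠ node t leaf → size x ≤ size t := by
    intro x hx hne
    rcases subt_cases hx with h | h | h
    · exact absurd h hne
    · exact subt_size h
    · rw [subt_leaf_eq h]; exact Nat.zero_le _
  have hchild : ∀ x ∈ subt (node t leaf), x ≠ node t leaf → x ≠ leaf → ∀ i,
      g (BT.child i x) ≤ n + 2 := by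
    intro x hx h1 h2 i
    have a := hsz x hx h1
    have b := size_child_lt i x h2
    apply gle
    · intro h
      rw [h] at b
      simp only [size] at b
      omega
    · intro h
      rw [h] at b
      omega
  have E1 : ∀ x ∈ subt (node t leaf), e1 n (g x) (g (BT.child false x)) = true := by
    intro x hx
    simp only [e1, Bool.or_eq_true, Bool.and_eq_true, decide_eq_true_eq]
    by_cases h1 : x = node t leaf
    · rw [h1, child_false, gr, gt]; omega
    by_cases h2 : x = t
    · have := hchild x hx h1 (by rw [h2]; exact htl) false
      rw [h2] at this ⊢
      rw [gt]; omega
    by_cases h3 : ∃ k, k ≤ n + 1 ∧ num k = x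
    · obtain ⟨k, hk, rfl⟩ := h3
      rw [num_false, gnum k hk, gnum (k - 1) (by omega)]; omega
    · have := hchild x hx h1 (by rintro rfl; exact h3 ⟨0, by omega, rfl⟩) false
      rw [gany x h1 h2 h3]; omega
  have E2 : ∀ x ∈ subt (node t leaf), e2 n (g x) (g (BT.child true x)) = true := by
    intro x hx
    simp only [e2, Bool.or_eq_true, Bool.and_eq_true, decide_eq_true_eq]
    by_cases h1 : x = node t leaf
    · rw [h1, child_true, gr, gleaf]; omega
    by_cases h2 : x = t
    · rw [h2, ht, gt, gnum _ le_rfl]; omega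
    by_cases h3 : ∃ k, k ≤ n + 1 ∧ num k = x
    · obtain ⟨k, hk, rfl⟩ := h3
      rw [num_true, gnum k hk, gleaf]; omega
    · have := hchild x hx h1 (by rintro rfl; exact h3 ⟨0, by omega, rfl⟩) true
      rw [gany x h1 h2 h3]; omega
  refine ⟨fun x => (⟨g x, glt x⟩ : Fin (n + 5)), fun _ _ => trivial, ?_, ?_, ?_, ?_⟩
  · rintro x y ⟨h, rfl⟩; exact E1 x h
  · rintro x y ⟨h, rfl⟩; exact E2 x h
  · intro x _
    constructor
    · intro h
      exact g4 x (congrArg Fin.val h)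
    · intro h
      apply Fin.ext
      change g x = n + 4
      rw [show x = node t leaf from h, gr]
  · intro x _
    constructor
    · intro h
      exact g0 x (congrArg Fin.val h)
    · intro h
      apply Fin.ext
      change g x = 0
      rw [show x = leaf from h, gleaf]

/-- The local situation of a homomorphism into the second graph. -/
structure Loc (φ ψ : Fm) (K : ℕ) (X : BT → Prop) (h : BT → Q K) : Prop where
  closed : ∀ x, X x → ∀ i, X (BT.child i x)
  hleaf : h leaf = none
  mid : ∀ x, X x → x ≠ leaf → ∃ m, h x = some (some m) ∧ Valid φ ψ m ∧
    ∀ i, step i m (h (BT.child i x))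

lemma Loc.get {φ ψ : Fm} {K : ℕ} {X : BT → Prop} {h : BT → Q K} (L : Loc φ ψ K X h) {s : BT}
    (hs : X s) {m : Mid K} (hm : h s = some (some m)) :
    s ≠ leaf ∧ Valid φ ψ m ∧ ∀ i, step i m (h (BT.child i s)) := by
  have hne : s ≠ leaf := by
    rintro rfl
    rw [L.hleaf] at hm
    cases hm
  obtain ⟨m', h1, h2, h3⟩ := L.mid s hs hne
  rw [hm] at h1
  cases h1
  exact ⟨hne, h2, h3⟩

lemma Loc.navX {φ ψ : Fm} {K : ℕ} {X : BT → Prop} {h : BT → Q K} (L : Loc φ ψ K X h)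
    (p : List Bool) : ∀ s, X s → X (nav BT.child p s) := by
  induction p with
  | nil => intro s hs; exact hs
  | cons i p ih => intro s hs; exact ih _ (L.closed s hs i)

lemma Loc.track {φ ψ : Fm} {K : ℕ} {X : BT → Prop} {h : BT → Q K} (L : Loc φ ψ K X h) {s : BT}
    (hs : X s) {m : Mid K} (hm : h s = some (some m))
    (h0 : (⟨[], Nat.zero_le _⟩ : W K) ∈ m.2.2.1) (p : List Bool) : ∀ hp : p.length ≤ K,
    (nav BT.child p s = leaf → (⟨p, hp⟩ : W K) ∈ m.1) ∧
    (nav BT.child p s ≠ leaf → ∃ m', h (nav BT.child p s) = some (some m') ∧ m'.1 = m.1 ∧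
      m'.2.1 = m.2.1 ∧ (⟨p, hp⟩ : W K) ∈ m'.2.2.1) := by
  obtain ⟨hne, hv, -⟩ := L.get hs hm
  induction p using List.reverseRecOn with
  | nil =>
    intro hp
    exact ⟨fun h => absurd h hne, fun _ => ⟨m, hm, rfl, rfl, h0⟩⟩
  | append_singleton p i ih =>
    intro hp
    have hp' : p.length ≤ K := by
      rw [List.length_append] at hp
      omega
    obtain ⟨i1, i2⟩ := ih hp'
    have hnav : nav BT.child (p ++ [i]) s = BT.child i (nav BT.child p s) := by
      rw [nav_append]; rfl
    rw [hnav]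
    by_cases hl : nav BT.child p s = leaf
    · rw [hl, child_leaf]
      exact ⟨fun _ => hv.closed _ (i1 hl) i hp, fun h => absurd rfl h⟩
    · obtain ⟨m', hm', e1, e2, hS⟩ := i2 hl
      obtain ⟨-, hv', hst⟩ := L.get (L.navX p s hs) hm'
      have hsti := hst i
      refine ⟨?_, ?_⟩
      · intro hc
        rw [hc, L.hleaf] at hsti
        rw [← e1]
        exact hsti.1 _ hS hp
      · intro hc
        obtain ⟨m'', hm'', -, -⟩ := L.mid _ (L.closed _ (L.navX p s hs) i) hc
        rw [hm''] at hsti ⊢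
        exact ⟨m'', rfl, hsti.1.trans e1, hsti.2.1.trans e2, hsti.2.2.1 _ hS hp⟩

lemma Loc.eval {φ ψ : Fm} {K : ℕ} {X : BT → Prop} {h : BT → Q K} (L : Loc φ ψ K X h) {s : BT}
    (hs : X s) {m : Mid K} (hm : h s = some (some m))
    (h0 : (⟨[], Nat.zero_le _⟩ : W K) ∈ m.2.2.1) (χ : Fm) (hχ : χ.bd ≤ K)
    (hsat : Sat BT.child leaf χ s) : χ.eval (liftN m.1) (liftE m.2.1) := by
  obtain ⟨-, hv, -⟩ := L.get hs hm
  refine Fm.eval_mono (K := K) ?_ ?_ χ hχ hsat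
  · intro p hp
    obtain ⟨t1, t2⟩ := L.track hs hm h0 p hp
    constructor
    · intro h; exact ⟨hp, t1 h⟩
    · rintro ⟨_, hN⟩
      by_contra hl
      obtain ⟨m', hm', e1, e2, hS⟩ := t2 hl
      obtain ⟨-, hv', -⟩ := L.get (L.navX p s hs) hm'
      exact hv'.disj _ hS (e1 ▸ hN)
  · intro p q hp hq e
    obtain ⟨t1, t2⟩ := L.track hs hm h0 p hp
    obtain ⟨u1, u2⟩ := L.track hs hm h0 q hq
    refine ⟨hp, hq, ?_⟩
    by_cases hl : nav BT.child p s = leaf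
    · exact hv.eqN _ (t1 hl) _ (u1 (e.symm.trans hl))
    · obtain ⟨m', hm', e1, e2, hS⟩ := t2 hl
      obtain ⟨m'', hm'', -, -, hS'⟩ := u2 (fun h => hl (e.trans h))
      have hmm : m'' = m' := by
        have e' : nav BT.child p s = nav BT.child q s := e
        rw [← e', hm'] at hm''
        cases hm''
        rfl
      subst hmm
      obtain ⟨-, hv', -⟩ := L.get (L.navX p s hs) hm'
      have := hv'.eqS _ hS _ hS'
      rw [e2] at this
      exact this

lemma Loc.no_on {φ ψ : Fm} {K : ℕ} {X : BT → Prop} {h : BT → Q K} (L : Loc φ ψ K X h)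
    (hφ : φ.bd ≤ K) : ∀ (k : ℕ) (s : BT), size s ≤ k → X s → Good φ s →
    ∀ m, h s = some (some m) → ¬ m.2.2.2.on := by
  intro k
  induction k with
  | zero =>
    intro s hk hs _ m hm _
    have hne := (L.get hs hm).1
    have := size_child_lt false s hne
    omega
  | succ k ih =>
    intro s hk hs hG m hm hon
    obtain ⟨hne, hv, hst⟩ := L.get hs hm
    have hdir : ∀ i, m.2.2.2 ≠ Flag.dir i := by
      intro i hi
      have hsti := hst i
      by_cases hc : BT.child i s = leaf
      · rw [hc, L.hleaf] at hsti
        exact hsti.2 hi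
      · obtain ⟨m', hm', -, -⟩ := L.mid _ (L.closed s hs i) hc
        rw [hm'] at hsti
        have := size_child_lt i s hne
        exact ih _ (by omega) (L.closed s hs i) (hG.nav [i]) m' hm' (hsti.2.2.2 hi)
    cases hfl : m.2.2.2 with
    | off => rw [hfl] at hon; exact hon
    | left => exact hdir false hfl
    | right => exact hdir true hfl
    | start => rw [hfl] at hon; exact hon
    | here =>
      obtain ⟨a, b⟩ := hv.here hfl
      exact b (L.eval hs hm a φ hφ (hG [] hne))

lemma TH_no_map (φ ψ : Fm) (K : ℕ) (hφ : φ.bd ≤ K) (hψ : ψ.bd ≤ K) (t : BT)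
    (hG : Good φ t) (hS : Sat BT.child leaf ψ t) :
    ¬ Maps (TH (node t leaf)) (QG φ ψ K) := by
  rintro ⟨h, hh⟩
  obtain ⟨-, hE, hr, hn⟩ := (isHom_iff _ _ _).1 hh
  have hE' : ∀ i, ∀ x ∈ subt (node t leaf), Qedge φ ψ K i (h x) (h (BT.child i x)) := by
    intro i x hx
    rw [← sb_QG]
    apply hE
    cases i
    · exact ⟨hx, rfl⟩
    · exact ⟨hx, rfl⟩
  have hroot : h (node t leaf) = some none := (hr _ (subt_self _)).2 rfl
  have htr : t ≠ node t leaf := by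
    intro h
    have := congrArg size h
    simp only [size] at this
    omega
  have L : Loc φ ψ K (fun x => x ∈ subt (node t leaf) ∧ x ≠ node t leaf) h := by
    refine ⟨?_, (hn _ (leaf_mem_subt _)).2 rfl, ?_⟩
    · rintro x ⟨hx, hne⟩ i
      refine ⟨subt_child hx i, ?_⟩
      intro he
      by_cases hl : x = leaf
      · rw [hl, child_leaf] at he
        cases he
      · have a := size_child_lt i x hl
        have b := subt_size hx
        rw [he] at a
        omega
    · rintro x ⟨hx, hne⟩ hl
      have h1 : h x ≠ none := fun e => hl ((hn x hx).1 e)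
      have h2 : h x ≠ some none := fun e => hne ((hr x hx).1 e)
      match hm : h x with
      | none => exact absurd hm h1
      | some none => exact absurd hm h2
      | some (some m) =>
        have he := fun i => hE' i x hx
        rw [hm] at he
        exact ⟨m, rfl, (he false).1, fun i => (he i).2⟩
  have hX : t ∈ subt (node t leaf) ∧ t ≠ node t leaf := ⟨⟨[false], rfl⟩, htr⟩
  have h1 := hE' false _ (subt_self _)
  rw [hroot] at h1
  obtain ⟨m, hm, hfl⟩ := h1.2 rfl
  rw [child_false] at hm
  have hon := L.no_on hφ _ t le_rfl hX hG m hm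
  cases hf : m.2.2.2 with
  | off => exact hfl hf
  | left => rw [hf] at hon; exact hon trivial
  | right => rw [hf] at hon; exact hon trivial
  | here => rw [hf] at hon; exact hon trivial
  | start =>
    obtain ⟨a, b⟩ := (L.get hX hm).2.1.start hf
    exact b (L.eval hX hm a ψ hψ hS)

theorem main : ¬ ComputablePred (fun m : ℕ =>
      ∃ G1 G2 : FinGraph, m = encodePair G1 G2 ∧
        HeapImplies G1.toPreGraph G2.toPreGraph) := by
  obtain ⟨c, hc⟩ := exists_universal
  obtain ⟨G2, hG2⟩ := exists_G2 (Phi c) (Phi0 c) (max (Phi c).bd (Phi0 c).bd)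
  refine reduction G2 c hc fun n => ?_
  rw [← tree_iff]
  constructor
  · intro h
    simp only [HeapImplies, not_forall] at h
    obtain ⟨γ, H, hH, hm, hno⟩ := h
    rw [hG2] at hno
    exact heap_to_tree _ _ _ (le_max_left _ _) (le_max_right _ _) n hH hm hno
  · rintro ⟨t, h1, h2, h3⟩ himp
    have := himp BT (TH (node t leaf)) (TH_heap _ (by simp)) (TH_maps n t h3)
    rw [hG2] at this
    exact TH_no_map _ _ _ (le_max_left _ _) (le_max_right _ _) t h1 h2 this

end HeapUndec

/-- The implication problem for regular graph constraints over the class of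
heaps is undecidable: the set of (codes of) pairs `⟨G1, G2⟩` of finite graphs
with `G1 ⇝_H G2` is not a computable set of natural numbers. -/
theorem implication_over_heaps_undecidable :
    ¬ ComputablePred (fun m : ℕ =>
      ∃ G1 G2 : FinGraph, m = encodePair G1 G2 ∧
        HeapImplies G1.toPreGraph G2.toPreGraph) := by
  exact HeapUndec.main
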